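/- Let m be a positive odd integer. Then ∫₀¹ log(x^(1/m) + 1)/(x + 1) dx = ((2 − m)/2)·log²2 + (m² − 1)π²/(24m) − (1/2)·Σ_{k=0}^{(m-3)/2} Li₂( cos²((2k+1)π/(2m)) ), where the sum is empty (equal to 0) when m = 1. -/

import Mathlib

open Real MeasureTheory intervalIntegral Finset

/-- Dilogarithm Li₂(z) = Σ_{k≥1} z^k/k². -/
noncomputable def Li2 (x : ℝ) : ℝ := ∑' k : ℕ, x ^ (k + 1) / ((k : ℝ) + 1) ^ 2

theorem qpos (c t : ℝ) (hc : c < 1) (ht : 0 ≤ t) : 0 < t ^ 2 - 2 * t * c + 1 := by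
  rcases eq_or_lt_of_le ht with h | h
  · subst h; norm_num
  · nlinarith [sq_nonneg (t - 1), mul_pos h (sub_pos.2 hc)]

theorem Li2_deriv (x : ℝ) (hx : |x| < 1) :
    HasDerivAt Li2 (∑' k : ℕ, x ^ k / ((k : ℝ) + 1)) x := by
  obtain ⟨r, hr1, hr2⟩ := exists_between hx
  have hr0 : 0 ≤ r := (abs_nonneg x).trans hr1.le
  have h := hasDerivAt_tsum_of_isPreconnected (𝕜 := ℝ) (u := fun k : ℕ => r ^ k)
    (t := Metric.ball (0:ℝ) r)
    (g := fun (k : ℕ) (x : ℝ) => x ^ (k + 1) / ((k : ℝ) + 1) ^ 2)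
    (g' := fun (k : ℕ) (x : ℝ) => x ^ k / ((k : ℝ) + 1)) (y₀ := 0) (y := x)
    (summable_geometric_of_lt_one hr0 hr2) Metric.isOpen_ball
    (convex_ball _ _).isPreconnected ?_ ?_ ?_ ?_ ?_
  · exact h
  · intro k y _
    have := (hasDerivAt_pow (k + 1) y).div_const (((k : ℝ) + 1) ^ 2)
    convert! this using 1
    push_cast
    have : (k : ℝ) + 1 ≠ 0 := by positivity
    field_simp
  · intro k y hy
    rw [Metric.mem_ball, dist_zero_right, Real.norm_eq_abs] at hy
    rw [norm_div, norm_pow, Real.norm_eq_abs, Real.norm_eq_abs, abs_of_pos (by positivity : (0:ℝ) < k + 1)]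
    have h1 : |y| ^ k ≤ r ^ k := pow_le_pow_left₀ (abs_nonneg _) hy.le _
    have h2 : |y| ^ k / ((k:ℝ) + 1) ≤ |y| ^ k :=
      div_le_self (by positivity) (by linarith [Nat.cast_nonneg (α := ℝ) k])
    exact h2.trans h1
  · simpa using (abs_nonneg x).trans_lt hr1
  · simp [summable_zero]
  · simpa using hr1

theorem Li2_deriv' (x : ℝ) (hx : 0 < x) (hx1 : x < 1) :
    HasDerivAt Li2 (-Real.log (1 - x) / x) x := by
  have hx' : |x| < 1 := by rwa [abs_of_pos hx]
  have h := Li2_deriv x hx'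
  have h2 := (Real.hasSum_pow_div_log_of_abs_lt_one hx').div_const x
  have h3 : (fun n : ℕ => x ^ (n + 1) / ((n:ℝ) + 1) / x) = fun n : ℕ => x ^ n / ((n:ℝ) + 1) := by
    funext n
    field_simp
    ring
  rw [h3] at h2
  rwa [h2.tsum_eq] at h

noncomputable def KK (c : ℝ) : ℝ := ∫ t in (0:ℝ)..1, Real.log (t ^ 2 - 2 * t * c + 1) / (1 + t)

theorem contI (c : ℝ) (hc : c < 1) :
    ContinuousOn (fun t : ℝ => Real.log (t ^ 2 - 2 * t * c + 1) / (1 + t)) (Set.uIcc 0 1) := by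
  rw [Set.uIcc_of_le zero_le_one]
  apply ContinuousOn.div
  · apply ContinuousOn.log
    · fun_prop
    · intro t ht
      exact (qpos c t hc ht.1).ne'
  · fun_prop
  · intro t ht
    linarith [ht.1]

theorem contI' (c : ℝ) (hc : c < 1) :
    ContinuousOn (fun t : ℝ => -(2 * t) / (t ^ 2 - 2 * t * c + 1) / (1 + t)) (Set.uIcc 0 1) := by
  rw [Set.uIcc_of_le zero_le_one]
  apply ContinuousOn.div
  · apply ContinuousOn.div
    · fun_prop
    · fun_prop
    · intro t ht
      exact (qpos c t hc ht.1).ne'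
  · fun_prop
  · intro t ht
    linarith [ht.1]

theorem KK_deriv (c : ℝ) (hc : c < 1) :
    HasDerivAt KK (∫ t in (0:ℝ)..1, -(2 * t) / (t ^ 2 - 2 * t * c + 1) / (1 + t)) c := by
  obtain ⟨c1, h1, h2⟩ : ∃ c1, max c 0 < c1 ∧ c1 < 1 := exists_between (max_lt hc one_pos)
  have hcc : c < c1 := (le_max_left _ _).trans_lt h1
  have hc0 : 0 < c1 := (le_max_right _ _).trans_lt h1
  have hI := fun c hc => (contI c hc).intervalIntegrable (μ := volume)
  have hI' := fun c hc => (contI' c hc).intervalIntegrable (μ := volume)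
  refine (intervalIntegral.hasDerivAt_integral_of_dominated_loc_of_deriv_le (μ := volume)
    (F := fun c t => Real.log (t ^ 2 - 2 * t * c + 1) / (1 + t))
    (F' := fun c t => -(2 * t) / (t ^ 2 - 2 * t * c + 1) / (1 + t))
    (bound := fun _ => 2 / (1 - c1 ^ 2)) (s := Set.Iio c1) (a := 0) (b := 1)
    (Iio_mem_nhds hcc) ?_ (hI c hc) ?_ ?_ ?_ ?_).2
  · filter_upwards [Iio_mem_nhds hc] with y hy
    exact (intervalIntegrable_iff.1 (hI y hy)).aestronglyMeasurable
  · exact (intervalIntegrable_iff.1 (hI' c hc)).aestronglyMeasurable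
  · refine Filter.Eventually.of_forall fun t ht x hx => ?_
    rw [Set.uIoc_of_le zero_le_one] at ht
    have hx : x < c1 := hx
    have ht0 := ht.1
    have ht1 := ht.2
    have hb : 1 - c1 ^ 2 ≤ t ^ 2 - 2 * t * x + 1 := by
      nlinarith [sq_nonneg (t - c1), mul_pos ht0 (sub_pos.2 hx)]
    have hp : 0 < 1 - c1 ^ 2 := by nlinarith
    rw [norm_div, norm_div, norm_neg, Real.norm_eq_abs, Real.norm_eq_abs, Real.norm_eq_abs,
      abs_of_pos (by linarith : 0 < 2 * t), abs_of_pos (by linarith : 0 < 1 + t),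
      abs_of_pos (hp.trans_le hb)]
    calc _ ≤ 2 * t / (t ^ 2 - 2 * t * x + 1) := div_le_self (by
            have := hp.trans_le hb
            positivity) (by linarith)
      _ ≤ _ := div_le_div₀ (by norm_num) (by linarith) hp hb
  · simp
  · refine Filter.Eventually.of_forall fun t ht x hx => ?_
    rw [Set.uIoc_of_le zero_le_one] at ht
    have hx : x < c1 := hx
    have hq := qpos x t (hx.trans h2) ht.1.le
    have h := (((((hasDerivAt_id x).const_mul (2 * t)).const_sub (t ^ 2)).add_const (1:ℝ)).log
      hq.ne').div_const (1 + t)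
    convert! h using 1
    simp

theorem int_eval (θ : ℝ) (h0 : 0 < θ) (h1 : θ < π) :
    (∫ t in (0:ℝ)..1, -(2 * t) / (t ^ 2 - 2 * t * Real.cos θ + 1) / (1 + t)) =
      1 / (1 + Real.cos θ) * (Real.log 2 - 1 / 2 * Real.log (2 - 2 * Real.cos θ))
        - (π - θ) / (2 * Real.sin θ) := by
  have hs : 0 < Real.sin θ := Real.sin_pos_of_pos_of_lt_pi h0 h1
  have hsc := Real.sin_sq_add_cos_sq θ
  have hc1 : Real.cos θ < 1 := by nlinarith [sq_nonneg (Real.cos θ - 1), Real.cos_le_one θ]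
  have hc2 : 0 < 1 + Real.cos θ := by nlinarith [Real.neg_one_le_cos θ]
  have e1 : Real.arctan ((1 - Real.cos θ) / Real.sin θ) = θ / 2 := by
    have : (1 - Real.cos θ) / Real.sin θ = Real.tan (θ / 2) := by
      rw [Real.tan_eq_sin_div_cos]
      have a : θ = 2 * (θ / 2) := by ring
      have hc : 0 < Real.cos (θ / 2) := Real.cos_pos_of_mem_Ioo ⟨by linarith, by linarith⟩
      have hs2 : 0 < Real.sin (θ / 2) := Real.sin_pos_of_pos_of_lt_pi (by linarith) (by linarith)
      have e := Real.sin_two_mul (θ / 2)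
      have e' := Real.cos_sq' (θ / 2)
      have e2 := Real.cos_two_mul (θ / 2)
      rw [← a] at e e2
      rw [div_eq_div_iff hs.ne' hc.ne', e, e2, e']
      ring
    rw [this, Real.arctan_tan (by linarith) (by linarith)]
  have e0 : Real.arctan ((0 - Real.cos θ) / Real.sin θ) = θ - π / 2 := by
    have : (0 - Real.cos θ) / Real.sin θ = Real.tan (θ - π / 2) := by
      rw [Real.tan_eq_sin_div_cos, Real.sin_sub_pi_div_two, Real.cos_sub_pi_div_two]
      simp
    rw [this, Real.arctan_tan (by linarith) (by linarith)]
  generalize Real.cos θ = c at *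
  generalize Real.sin θ = s at *
  have key := intervalIntegral.integral_eq_sub_of_hasDerivAt (a := 0) (b := 1)
    (f := fun t : ℝ => 1 / (1 + c) * (Real.log (1 + t) - 1 / 2 * Real.log (t ^ 2 - 2 * t * c + 1))
      - 1 / s * Real.arctan ((t - c) / s))
    (f' := fun t : ℝ => -(2 * t) / (t ^ 2 - 2 * t * c + 1) / (1 + t)) ?_
    ((contI' c hc1).intervalIntegrable)
  · rw [key, e1, e0]
    norm_num
    rw [show (1:ℝ) - 2 * c + 1 = 2 - 2 * c by ring]
    field_simp
    ring
  · intro t ht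
    rw [Set.uIcc_of_le zero_le_one] at ht
    have hq := qpos c t hc1 ht.1
    have ht1 : 0 < 1 + t := by linarith [ht.1]
    have d1 : HasDerivAt (fun t : ℝ => Real.log (1 + t)) (1 / (1 + t)) t :=
      ((hasDerivAt_id t).const_add 1).log ht1.ne'
    have d2 : HasDerivAt (fun t : ℝ => Real.log (t ^ 2 - 2 * t * c + 1))
        ((2 * t - 2 * c) / (t ^ 2 - 2 * t * c + 1)) t := by
      have : HasDerivAt (fun t : ℝ => t ^ 2 - 2 * t * c + 1) (2 * t - 2 * c) t := by
        have := (((hasDerivAt_pow 2 t).sub (((hasDerivAt_id t).const_mul 2).mul_const c)).add_const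
          (1:ℝ))
        convert! this using 1
        simp
      exact this.log hq.ne'
    have d3 : HasDerivAt (fun t : ℝ => Real.arctan ((t - c) / s))
        (1 / (1 + ((t - c) / s) ^ 2) * (1 / s)) t :=
      (((hasDerivAt_id t).sub_const c).div_const s).arctan
    have h := ((d1.sub (d2.const_mul (1 / 2))).const_mul (1 / (1 + c))).sub (d3.const_mul (1 / s))
    convert! h using 1
    have e : 1 / (1 + ((t - c) / s) ^ 2) * (1 / s) = s / (t ^ 2 - 2 * t * c + 1) := by
      have : 1 + ((t - c) / s) ^ 2 = (t ^ 2 - 2 * t * c + 1) / s ^ 2 := by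
        field_simp
        linear_combination hsc
      rw [this]
      field_simp
    rw [e]
    obtain ⟨q, hqe⟩ : ∃ q, q = t ^ 2 - 2 * t * c + 1 := ⟨_, rfl⟩
    rw [← hqe] at hq ⊢
    have hq' := hq.ne'
    field_simp
    rw [hqe]
    ring

theorem int_log : (∫ t in (0:ℝ)..1, Real.log (1 + t) / (1 + t)) = Real.log 2 ^ 2 / 2 := by
  have key := intervalIntegral.integral_eq_sub_of_hasDerivAt (a := 0) (b := 1)
    (f := fun t : ℝ => Real.log (1 + t) ^ 2 / 2)
    (f' := fun t : ℝ => Real.log (1 + t) / (1 + t)) ?_ ?_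
  · rw [key]
    norm_num
  · intro t ht
    rw [Set.uIcc_of_le zero_le_one] at ht
    have ht1 : 0 < 1 + t := by linarith [ht.1]
    have d1 : HasDerivAt (fun t : ℝ => Real.log (1 + t)) (1 / (1 + t)) t :=
      ((hasDerivAt_id t).const_add 1).log ht1.ne'
    have h := (d1.pow 2).div_const 2
    convert! h using 1
    field_simp
    norm_num
    ring
  · apply ContinuousOn.intervalIntegrable
    rw [Set.uIcc_of_le zero_le_one]
    apply ContinuousOn.div
    · apply ContinuousOn.log
      · fun_prop
      · intro t ht
        linarith [ht.1]
    · fun_prop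
    · intro t ht
      linarith [ht.1]

theorem KK_neg_one : KK (-1) = Real.log 2 ^ 2 := by
  have : KK (-1) = ∫ t in (0:ℝ)..1, 2 * (Real.log (1 + t) / (1 + t)) := by
    unfold KK
    congr 1
    funext t
    rw [show t ^ 2 - 2 * t * (-1) + 1 = (1 + t) ^ 2 by ring, Real.log_pow]
    push_cast
    ring
  rw [this, intervalIntegral.integral_const_mul, int_log]
  ring

theorem KK_eval (θ : ℝ) (h0 : 0 < θ) (h1 : θ ≤ π) :
    KK (Real.cos θ) = Real.log 2 ^ 2 + 1 / 2 * Li2 (Real.cos (θ / 2) ^ 2) - (π - θ) ^ 2 / 4 := by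
  have hd : ∀ x ∈ Set.Icc θ π, HasDerivAt (fun x => KK (Real.cos x)
      - 1 / 2 * Li2 (Real.cos (x / 2) ^ 2) + (π - x) ^ 2 / 4)
      ((∫ t in (0:ℝ)..1, -(2 * t) / (t ^ 2 - 2 * t * Real.cos x + 1) / (1 + t)) * (-Real.sin x)
        - 1 / 2 * ((deriv Li2 (Real.cos (x / 2) ^ 2)) * (- Real.cos (x / 2) * Real.sin (x / 2)))
        - (π - x) / 2) x := by
    intro x hx
    have hx0 : 0 < x := h0.trans_le hx.1
    have hs2 : 0 < Real.sin (x / 2) :=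
      Real.sin_pos_of_pos_of_lt_pi (by linarith) (by linarith [hx.2, Real.pi_pos])
    have hc2 := Real.cos_sq' (x / 2)
    have hlt : Real.cos (x / 2) ^ 2 < 1 := by nlinarith
    have hc1 : Real.cos x < 1 := by
      have e2 := Real.cos_two_mul (x / 2)
      rw [show 2 * (x / 2) = x by ring] at e2
      linarith
    have dL := (Li2_deriv _ (by rwa [abs_of_nonneg (sq_nonneg (Real.cos (x / 2)))])).differentiableAt.hasDerivAt
    have dc : HasDerivAt (fun x : ℝ => Real.cos (x / 2) ^ 2)
        (- Real.cos (x / 2) * Real.sin (x / 2)) x := by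
      have := (((hasDerivAt_id x).div_const 2).cos).pow 2
      convert! this using 1
      simp
      ring
    have d1 := (KK_deriv _ hc1).comp x (Real.hasDerivAt_cos x)
    have d2 := HasDerivAt.comp x dL dc
    have d3 : HasDerivAt (fun x : ℝ => (π - x) ^ 2 / 4) (-((π - x) / 2)) x := by
      have := (((hasDerivAt_id x).const_sub π).pow 2).div_const 4
      convert! this using 1
      simp
      ring
    exact (d1.sub (d2.const_mul (1 / 2))).add d3
  have hz : ∀ x ∈ Set.Ico θ π, (∫ t in (0:ℝ)..1, -(2 * t) / (t ^ 2 - 2 * t * Real.cos x + 1) / (1 + t)) * (-Real.sin x)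
        - 1 / 2 * ((deriv Li2 (Real.cos (x / 2) ^ 2)) * (- Real.cos (x / 2) * Real.sin (x / 2)))
        - (π - x) / 2 = 0 := by
    intro x hx
    have hx0 : 0 < x := h0.trans_le hx.1
    have hs2 : 0 < Real.sin (x / 2) :=
      Real.sin_pos_of_pos_of_lt_pi (by linarith) (by linarith [hx.2, Real.pi_pos])
    have hcp : 0 < Real.cos (x / 2) := Real.cos_pos_of_mem_Ioo ⟨by linarith, by linarith [hx.2]⟩
    have hc2 := Real.cos_sq' (x / 2)
    have hlt : Real.cos (x / 2) ^ 2 < 1 := by nlinarith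
    have hs : 0 < Real.sin x := Real.sin_pos_of_pos_of_lt_pi hx0 hx.2
    rw [int_eval x hx0 hx.2, (Li2_deriv' _ (by positivity) hlt).deriv]
    have e2 := Real.cos_two_mul (x / 2)
    have e1 := Real.sin_two_mul (x / 2)
    rw [show 2 * (x / 2) = x by ring] at e2 e1
    have l1 : Real.log (1 - Real.cos (x / 2) ^ 2) = 2 * Real.log (Real.sin (x / 2)) := by
      rw [hc2, sub_sub_cancel, Real.log_pow]; norm_num
    have l2 : Real.log (2 - 2 * Real.cos x) = 2 * (Real.log 2 + Real.log (Real.sin (x / 2))) := by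
      rw [← Real.log_mul (by norm_num) hs2.ne', e2, hc2]
      have : 2 - 2 * (2 * (1 - Real.sin (x / 2) ^ 2) - 1) = (2 * Real.sin (x / 2)) ^ 2 := by ring
      rw [this, Real.log_pow]; norm_num
    rw [l1, l2, e2, e1]
    have : 1 + (2 * Real.cos (x / 2) ^ 2 - 1) = 2 * Real.cos (x / 2) ^ 2 := by ring
    rw [this]
    field_simp
    ring
  have := constant_of_has_deriv_right_zero (fun x hx => (hd x hx).continuousAt.continuousWithinAt)
    (fun x hx => by
      have h := (hd x ⟨hx.1, hx.2.le⟩).hasDerivWithinAt (s := Set.Ici x)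
      rwa [hz x hx] at h) π ⟨h1, le_rfl⟩
  simp only [Real.cos_pi, Real.cos_pi_div_two, KK_neg_one] at this
  have l0 : Li2 (0 ^ 2) = 0 := by simp [Li2]
  rw [l0] at this
  linarith

theorem factC (n : ℕ) (t : ℂ) : t ^ (2 * n + 1) + 1 =
    ∏ i ∈ Finset.range (2 * n + 1),
      (t - Complex.exp (((2 * i + 1) * π / (2 * n + 1 : ℝ) : ℝ) * Complex.I)) := by
  have hp := Complex.isPrimitiveRoot_exp (2 * n + 1) (by omega)
  have hm : ((2 * n + 1 : ℕ) : ℂ) ≠ 0 := by exact_mod_cast (by omega : 2 * n + 1 ≠ 0)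
  have hy : Complex.exp (π * Complex.I / (2 * n + 1 : ℕ)) ^ (2 * n + 1) = -1 := by
    rw [← Complex.exp_nat_mul, mul_div_cancel₀ _ hm, Complex.exp_pi_mul_I]
  have h := hp.pow_sub_pow_eq_prod_sub_mul t (Complex.exp (π * Complex.I / (2 * n + 1 : ℕ)))
    (by omega)
  rw [hy, sub_neg_eq_add] at h
  rw [h]
  symm
  refine Finset.prod_bij (fun i _ => Complex.exp (2 * π * Complex.I / (2 * n + 1 : ℕ)) ^ i) ?_ ?_ ?_ ?_
  · intro i _
    rw [Polynomial.mem_nthRootsFinset (by omega), pow_right_comm, hp.pow_eq_one, one_pow]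
  · intro i hi j hj hij
    exact hp.pow_inj (Finset.mem_range.1 hi) (Finset.mem_range.1 hj) hij
  · intro z hz
    rw [Polynomial.mem_nthRootsFinset (by omega)] at hz
    obtain ⟨i, hi, h⟩ := hp.eq_pow_of_pow_eq_one hz
    exact ⟨i, Finset.mem_range.2 hi, h⟩
  · intro i _
    rw [← Complex.exp_nat_mul, ← Complex.exp_add]
    congr 2
    push_cast at hm ⊢
    field_simp

theorem factR (n : ℕ) (t : ℝ) : t ^ (2 * n + 1) + 1 = (1 + t) *
    ∏ k ∈ Finset.range n,
      (t ^ 2 - 2 * t * Real.cos ((2 * k + 1) * π / (2 * n + 1)) + 1) := by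
  have h := factC n t
  have hm : (2 * (n:ℝ) + 1) ≠ 0 := by positivity
  rw [show 2 * n + 1 = n + 1 + n by ring, Finset.prod_range_add, Finset.prod_range_succ,
    ← Finset.prod_range_reflect (fun x => (t:ℂ) - Complex.exp (((2 * ((n + 1 + x : ℕ) : ℝ) + 1) * π / (2 * n + 1 : ℝ) : ℝ) * Complex.I)),
    mul_right_comm, ← Finset.prod_mul_distrib] at h
  rw [mul_div_cancel_left₀ _ hm, Complex.exp_pi_mul_I] at h
  apply Complex.ofReal_injective
  push_cast
  rw [show 2 * n + 1 = n + 1 + n by ring, h, mul_comm]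
  congr 1
  · ring
  · apply Finset.prod_congr rfl
    intro k hk
    have hk := Finset.mem_range.1 hk
    have e : ((2 * ((n + 1 + (n - 1 - k) : ℕ) : ℝ) + 1) * π / (2 * n + 1 : ℝ) : ℝ)
        = 2 * π - (2 * k + 1) * π / (2 * n + 1) := by
      rw [show n + 1 + (n - 1 - k) = 2 * n - k by omega, Nat.cast_sub (by omega)]
      push_cast
      field_simp
      ring
    rw [e]
    have e3 : ((2 * (k:ℂ) + 1) * π / (2 * n + 1)) = (((2 * k + 1) * π / (2 * n + 1) : ℝ) : ℂ) := by
      push_cast; rfl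
    rw [e3]
    generalize (2 * (k:ℝ) + 1) * π / (2 * n + 1) = φ
    rw [Complex.exp_mul_I, Complex.exp_mul_I, ← Complex.ofReal_cos, ← Complex.ofReal_cos,
      ← Complex.ofReal_sin, ← Complex.ofReal_sin, Real.cos_two_pi_sub, Real.sin_two_pi_sub]
    have hsc : ((Real.sin φ : ℝ) : ℂ) ^ 2 + ((Real.cos φ : ℝ) : ℂ) ^ 2 = 1 := by
      exact_mod_cast Real.sin_sq_add_cos_sq φ
    push_cast at hsc ⊢
    linear_combination hsc - Complex.sin φ ^ 2 * Complex.I_sq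

theorem step1 (m : ℕ) (hm0 : 0 < m) :
    ∫ x in (0:ℝ)..1, Real.log (x ^ ((1 : ℝ) / m) + 1) / (x + 1) =
      Real.log 2 ^ 2 - ∫ t in (0:ℝ)..1, Real.log (t ^ m + 1) / (1 + t) := by
  have hmR : (m:ℝ) ≠ 0 := by positivity
  have hpm : ∀ t ∈ Set.uIcc (0:ℝ) 1, 0 < t ^ m + 1 := by
    intro t ht
    rw [Set.uIcc_of_le zero_le_one] at ht
    have := pow_nonneg ht.1 m
    linarith
  have hp1 : ∀ t ∈ Set.uIcc (0:ℝ) 1, 0 < 1 + t := by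
    intro t ht
    rw [Set.uIcc_of_le zero_le_one] at ht
    linarith [ht.1]
  have sub := intervalIntegral.integral_comp_mul_deriv'' (a := 0) (b := 1)
    (f := fun t : ℝ => t ^ m) (f' := fun t : ℝ => m * t ^ (m - 1))
    (g := fun x : ℝ => Real.log (x ^ ((1 : ℝ) / m) + 1) / (x + 1)) (by fun_prop)
    (fun x _ => (hasDerivAt_pow m x).hasDerivWithinAt) (by fun_prop) ?_
  · rw [zero_pow hm0.ne', one_pow] at sub
    rw [← sub]
    have parts := intervalIntegral.integral_mul_deriv_eq_deriv_mul (a := 0) (b := 1)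
      (u := fun t : ℝ => Real.log (1 + t)) (v := fun t : ℝ => Real.log (t ^ m + 1))
      (u' := fun t : ℝ => 1 / (1 + t)) (v' := fun t : ℝ => m * t ^ (m - 1) / (t ^ m + 1))
      (fun t ht => ((hasDerivAt_id t).const_add 1).log (hp1 t ht).ne')
      (fun t ht => ((hasDerivAt_pow m t).add_const 1).log (hpm t ht).ne')
      (ContinuousOn.intervalIntegrable (ContinuousOn.div (by fun_prop) (by fun_prop)
        fun t ht => (hp1 t ht).ne'))
      (ContinuousOn.intervalIntegrable (ContinuousOn.div (by fun_prop) (by fun_prop)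
        fun t ht => (hpm t ht).ne'))
    have e1 : (∫ t in (0:ℝ)..1, Real.log (1 + t) * (m * t ^ (m - 1) / (t ^ m + 1))) =
        ∫ x in (0:ℝ)..1, ((fun x : ℝ => Real.log (x ^ ((1 : ℝ) / m) + 1) / (x + 1)) ∘ fun t => t ^ m) x
          * (m * x ^ (m - 1)) := by
      apply intervalIntegral.integral_congr
      intro t ht
      have h0 : 0 ≤ t := by
        rw [Set.uIcc_of_le zero_le_one] at ht
        exact ht.1
      simp only [Function.comp]
      rw [← Real.rpow_natCast_mul h0, mul_one_div_cancel hmR, Real.rpow_one, add_comm t 1]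
      ring
    rw [← e1, parts]
    congr 1
    · norm_num [hm0.ne']
      ring
    · congr 1
      funext t
      ring
  · intro x hx
    obtain ⟨t, ht, rfl⟩ := hx
    have hx : (0:ℝ) ≤ t ^ m := by
      rw [Set.uIcc_of_le zero_le_one] at ht
      exact pow_nonneg ht.1 m
    have h2 : 0 ≤ (t ^ m) ^ ((1:ℝ) / m) := Real.rpow_nonneg hx _
    apply ContinuousAt.continuousWithinAt
    apply ContinuousAt.div
    · apply ContinuousAt.log
      · exact (Real.continuousAt_rpow_const _ _ (Or.inr (by positivity))).add continuousAt_const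
      · positivity
    · fun_prop
    · positivity

theorem stmt_4 (m : ℕ) (hm : Odd m) (hm0 : 0 < m) :
    ∫ x in (0:ℝ)..1, Real.log (x ^ ((1 : ℝ) / m) + 1) / (x + 1) =
      (2 - (m : ℝ)) / 2 * Real.log 2 ^ 2 + ((m : ℝ) ^ 2 - 1) * π ^ 2 / (24 * m)
        - (1 / 2) * ∑ k ∈ Finset.range ((m - 1) / 2),
            Li2 (Real.cos ((2 * (k : ℝ) + 1) * π / (2 * m)) ^ 2) := by
  rw [step1 m hm0]
  obtain ⟨n, rfl⟩ := hm
  rw [show (2 * n + 1 - 1) / 2 = n by omega]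
  have hn : (0:ℝ) < 2 * n + 1 := by positivity
  have hθ : ∀ k ∈ Finset.range n, 0 < (2 * (k:ℝ) + 1) * π / (2 * n + 1) ∧
      (2 * (k:ℝ) + 1) * π / (2 * n + 1) < π := by
    intro k hk
    have hk : (k:ℝ) < n := by exact_mod_cast Finset.mem_range.1 hk
    refine ⟨by positivity, ?_⟩
    rw [div_lt_iff₀ hn]
    nlinarith [Real.pi_pos]
  have hc : ∀ k ∈ Finset.range n, Real.cos ((2 * (k:ℝ) + 1) * π / (2 * n + 1)) < 1 := by
    intro k hk
    obtain ⟨a, b⟩ := hθ k hk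
    have := Real.cos_lt_cos_of_nonneg_of_le_pi le_rfl b.le a
    rwa [Real.cos_zero] at this
  have e : (∫ t in (0:ℝ)..1, Real.log (t ^ (2 * n + 1) + 1) / (1 + t)) =
      ∫ t in (0:ℝ)..1, (Real.log (1 + t) / (1 + t) + ∑ k ∈ Finset.range n,
        Real.log (t ^ 2 - 2 * t * Real.cos ((2 * (k:ℝ) + 1) * π / (2 * n + 1)) + 1) / (1 + t)) := by
    apply intervalIntegral.integral_congr
    intro t ht
    have h0 : 0 ≤ t := by
      rw [Set.uIcc_of_le zero_le_one] at ht
      exact ht.1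
    have hq : ∀ k ∈ Finset.range n,
        t ^ 2 - 2 * t * Real.cos ((2 * (k:ℝ) + 1) * π / (2 * n + 1)) + 1 ≠ 0 :=
      fun k hk => (qpos _ t (hc k hk) h0).ne'
    simp only
    rw [factR, Real.log_mul (by positivity) (Finset.prod_ne_zero_iff.2 hq), Real.log_prod hq,
      add_div, Finset.sum_div]
  have hI1 : IntervalIntegrable (fun t : ℝ => Real.log (1 + t) / (1 + t)) volume 0 1 := by
    apply ContinuousOn.intervalIntegrable
    rw [Set.uIcc_of_le zero_le_one]
    apply ContinuousOn.div
    · apply ContinuousOn.log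
      · fun_prop
      · intro t ht
        linarith [ht.1]
    · fun_prop
    · intro t ht
      linarith [ht.1]
  have hI2 : ∀ k ∈ Finset.range n, IntervalIntegrable (fun t : ℝ => Real.log (t ^ 2 - 2 * t *
      Real.cos ((2 * (k:ℝ) + 1) * π / (2 * n + 1)) + 1) / (1 + t)) volume 0 1 :=
    fun k hk => (contI _ (hc k hk)).intervalIntegrable
  rw [e, intervalIntegral.integral_add hI1 (by
    have := IntervalIntegrable.sum _ hI2
    convert! this using 1
    funext t
    simp), int_log, intervalIntegral.integral_finsetSum hI2]
  have e2 : ∀ k ∈ Finset.range n, (∫ t in (0:ℝ)..1, Real.log (t ^ 2 - 2 * t *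
      Real.cos ((2 * (k:ℝ) + 1) * π / (2 * n + 1)) + 1) / (1 + t)) =
      Real.log 2 ^ 2 + 1 / 2 * Li2 (Real.cos ((2 * (k : ℝ) + 1) * π / (2 * (2 * n + 1 : ℕ))) ^ 2)
        - (π ^ 2 / (2 * n + 1) ^ 2) * ((n:ℝ) - k) ^ 2 := by
    intro k hk
    have := KK_eval _ (hθ k hk).1 (hθ k hk).2.le
    rw [KK] at this
    rw [this]
    congr 1
    · congr 5
      push_cast
      field_simp
    · field_simp
      ring
  rw [Finset.sum_congr rfl e2, Finset.sum_sub_distrib, Finset.sum_add_distrib, ← Finset.mul_sum,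
    ← Finset.mul_sum]
  have e3 : ∀ N : ℕ, ∑ k ∈ Finset.range N, ((N:ℝ) - k) ^ 2 = N * (N + 1) * (2 * N + 1) / 6 := by
    intro N
    induction N with
    | zero => simp
    | succ N ih =>
      rw [Finset.sum_range_succ']
      have : ∀ k ∈ Finset.range N, (((N + 1 : ℕ) : ℝ) - ((k + 1 : ℕ) : ℝ)) ^ 2 = ((N:ℝ) - k) ^ 2 := by
        intro k _
        push_cast
        ring
      rw [Finset.sum_congr rfl this, ih]
      push_cast
      ring
  rw [e3]
  generalize (∑ k ∈ Finset.range n,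
    Li2 (Real.cos ((2 * (k : ℝ) + 1) * π / (2 * (2 * n + 1 : ℕ))) ^ 2)) = S
  simp only [Finset.sum_const, Finset.card_range, nsmul_eq_mul]
  push_cast
  field_simp
  ring
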